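/- arXiv:1805.12486 — 2 statements merged into one kernel-verified Lean document; each statement's English description precedes it below -/
import Mathlib

section
/- Let ι > 0 and m̄ ∈ ℝ, and let G be a real random variable whose law is the Gaussian law on ℝ with mean m̄ and variance ι, and let s ∈ ℝ with s ≠ 0. Let v : ℝ → ℝ be a continuously differentiable, strictly increasing bijection of ℝ onto ℝ, and suppose there are constants a ≥ 0, b > 0, C₁ > 0, C₂ > 0, L > 0, λ > 0 such that for all x ∈ ℝ: (i) 0 < v′(x) ≤ C₁(1+|x|^a); (ii) |v⁻¹(x)| ≤ C₂(1+|x|^b); (iii) v′(x) ≥ 1/(L(1+|x|^λ)). Set Z := s·v(G) and ν := E[Z]. Then the law of Z is absolutely continuous with respect to Lebesgue measure with density ρ_Z, and there exist constants K₁, K₂ > 0 such that for almost every z ∈ ℝ: E|Z−ν| / (K₁ s² ι (1+|z|^{ab})(1+|z|^{ab}+ι^{a/2})) · exp(−(1/(K₂ s² ι)) ∫₀^{z−ν} w(1+|w+ν|^{2λb}) dw) ≤ ρ_Z(z) ≤ (E|Z−ν|/(K₂ s² ι)) (1+|z|^{2λb}) · exp(−(1/(K₁ s² ι)) ∫₀^{z−ν}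 w / ((1+|w+ν|^{ab})(1+|w+ν|^{ab}+ι^{a/2})) dw). -/
open MeasureTheory ProbabilityTheory

/-- The sign pattern of a function that decreases before `c` and increases after it. -/
lemma le_of_sub_mul_hasDerivAt_nonneg {f f' : ℝ → ℝ} {c : ℝ}
    (hf : ∀ z, HasDerivAt f (f' z) z) (h : ∀ z, 0 ≤ (z - c) * f' z) (z : ℝ) : f c ≤ f z := by
  have hcont : Continuous f := continuous_iff_continuousAt.2 fun x => (hf x).continuousAt
  have hdiff : Differentiable ℝ f := fun x => (hf x).differentiableAt
  rcases le_total c z with hz | hz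
  · refine monotoneOn_of_deriv_nonneg (convex_Ici c) hcont.continuousOn hdiff.differentiableOn
      (fun x hx => ?_) Set.self_mem_Ici hz hz
    rw [interior_Ici, Set.mem_Ioi] at hx
    rw [(hf x).deriv]
    exact nonneg_of_mul_nonneg_right (h x) (sub_pos.2 hx)
  · refine antitoneOn_of_deriv_nonpos (convex_Iic c) hcont.continuousOn hdiff.differentiableOn
      (fun x hx => ?_) hz Set.self_mem_Iic hz
    rw [interior_Iic, Set.mem_Iio] at hx
    rw [(hf x).deriv]
    nlinarith [h x]

lemma hasDerivAt_integral_zero_sub {k : ℝ → ℝ} (hk : Continuous k) (c z : ℝ) :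
    HasDerivAt (fun z => ∫ w in (0:ℝ)..(z - c), k w) (k (z - c)) z := by
  have h := intervalIntegral.integral_hasDerivAt_right (hk.intervalIntegrable 0 (z - c))
    (hk.stronglyMeasurableAtFilter _ _) hk.continuousAt
  simpa using h.comp_sub_const z c

lemma integral_zero_sub_nonneg {k : ℝ → ℝ} (hk : Continuous k) (h : ∀ w, 0 ≤ w * k w) (c z : ℝ) :
    0 ≤ ∫ w in (0:ℝ)..(z - c), k w := by
  simpa using le_of_sub_mul_hasDerivAt_nonneg (c := c)
    (fun z => hasDerivAt_integral_zero_sub hk c z) (fun z => h (z - c)) z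

lemma continuous_one_add_abs_add_rpow {q : ℝ} (hq : 0 ≤ q) (c : ℝ) :
    Continuous fun w : ℝ => 1 + |w + c| ^ q :=
  continuous_const.add ((continuous_id.add continuous_const).abs.rpow_const fun _ => Or.inr hq)

lemma abs_sub_le_of_abs_deriv_le_rpow {f f' : ℝ → ℝ} {C q : ℝ} (hq : 0 ≤ q) (hC : 0 ≤ C)
    (hf : ∀ z, HasDerivAt f (f' z) z) (h : ∀ z, |f' z| ≤ C * (1 + |z| ^ q)) (c z : ℝ) :
    |f z - f c| ≤ C * (1 + |c| ^ q) * (1 + |z| ^ q) * |z - c| := by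
  refine (convex_uIcc c z).norm_image_sub_le_of_norm_hasDerivWithin_le (f' := f')
    (fun x _ => (hf x).hasDerivWithinAt) (fun x hx => (h x).trans ?_)
    Set.left_mem_uIcc Set.right_mem_uIcc
  have hc : 0 ≤ |c| ^ q := by positivity
  have hz : 0 ≤ |z| ^ q := by positivity
  have hx' : |x| ^ q ≤ |c| ^ q + |z| ^ q := by
    have hmax : |x| ≤ max |c| |z| := by
      rcases Set.mem_uIcc.1 hx with ⟨h1, h2⟩ | ⟨h1, h2⟩
      · exact abs_le_max_abs_abs h1 h2
      · exact (abs_le_max_abs_abs h1 h2).trans (max_comm _ _).le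
    rcases le_max_iff.1 hmax with h1 | h1
    · linarith [Real.rpow_le_rpow (abs_nonneg x) h1 hq]
    · linarith [Real.rpow_le_rpow (abs_nonneg x) h1 hq]
  rw [mul_assoc]
  gcongr
  nlinarith [mul_nonneg hc hz]

lemma exists_one_add_rpow_le {b C q : ℝ} (hq : 0 ≤ q) (hC : 0 ≤ C) :
    ∃ K, 0 < K ∧ ∀ x z : ℝ, |x| ≤ C * (1 + |z| ^ b) → 1 + |x| ^ q ≤ K * (1 + |z| ^ (q * b)) := by
  refine ⟨1 + (2 * C) ^ q, by positivity, fun x z h => ?_⟩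
  have ht : 0 ≤ |z| ^ b := by positivity
  have hmul : |z| ^ (q * b) = (|z| ^ b) ^ q := by
    rw [mul_comm, Real.rpow_mul (abs_nonneg z)]
  have hD : 0 ≤ (2 * C) ^ q := by positivity
  have hT : 0 ≤ (|z| ^ b) ^ q := by positivity
  rw [hmul]
  have hx : |x| ^ q ≤ (2 * C) ^ q * (1 + (|z| ^ b) ^ q) := by
    rcases le_total (|z| ^ b) 1 with h1 | h1
    · have := Real.rpow_le_rpow (abs_nonneg x) (show |x| ≤ 2 * C by nlinarith) hq
      nlinarith
    · have := Real.rpow_le_rpow (abs_nonneg x) (show |x| ≤ 2 * C * |z| ^ b by nlinarith) hq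
      rw [Real.mul_rpow (by positivity) ht] at this
      nlinarith
  nlinarith

lemma continuous_mul_one_add_abs_add_rpow {q : ℝ} (hq : 0 ≤ q) (c : ℝ) :
    Continuous fun w : ℝ => w * (1 + |w + c| ^ q) :=
  continuous_id.mul (continuous_one_add_abs_add_rpow hq c)

lemma integral_mul_one_add_abs_add_rpow_nonneg {q : ℝ} (hq : 0 ≤ q) (c z : ℝ) :
    0 ≤ ∫ w in (0:ℝ)..(z - c), w * (1 + |w + c| ^ q) :=
  integral_zero_sub_nonneg (continuous_mul_one_add_abs_add_rpow hq c) (fun w => by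
    rw [← mul_assoc]; exact mul_nonneg (mul_self_nonneg w) (by positivity)) c z

/-- A function whose derivative grows at most like `|z| ^ q` is controlled by
`∫ w (1 + |w + c| ^ (2 q))`. -/
lemma exists_sq_le_integral {u u' : ℝ → ℝ} {C q r : ℝ} (hq : 0 ≤ q) (hC : 0 ≤ C) (hr : r = q * 2)
    (hu : ∀ z, HasDerivAt u (u' z) z) (h : ∀ z, |u' z| ≤ C * (1 + |z| ^ q)) (c : ℝ) :
    ∃ K, 0 < K ∧ ∀ z, u z ^ 2 ≤
      K * (1 + ∫ w in (0:ℝ)..(z - c), w * (1 + |w + c| ^ r)) := by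
  have hr0 : 0 ≤ r := by rw [hr]; positivity
  have hk := continuous_mul_one_add_abs_add_rpow hr0 c
  set B := C * (1 + |c| ^ q) with hB
  have hB0 : 0 ≤ B := by positivity
  have key : ∀ z, (u z - u c) ^ 2 ≤
      4 * B * C * ∫ w in (0:ℝ)..(z - c), w * (1 + |w + c| ^ r) := by
    intro z
    have hd : ∀ z, HasDerivAt
        (fun z => 4 * B * C * (∫ w in (0:ℝ)..(z - c), w * (1 + |w + c| ^ r)) - (u z - u c) ^ 2)
        (4 * B * C * ((z - c) * (1 + |z - c + c| ^ r)) - 2 * (u z - u c) * u' z) z := by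
      intro z
      refine ((hasDerivAt_integral_zero_sub hk c z).const_mul _).sub ?_
      simpa using ((hu z).sub_const (u c)).fun_pow 2
    have := le_of_sub_mul_hasDerivAt_nonneg (c := c) hd (fun z => ?_) z
    · simpa using this
    · rw [sub_add_cancel]
      have h1 := abs_sub_le_of_abs_deriv_le_rpow hq hC hu h c z
      have h2 := h z
      rw [← hB] at h1
      have hrt : |z| ^ r = (|z| ^ q) ^ 2 := by
        rw [hr, Real.rpow_mul (abs_nonneg z), Real.rpow_two]
      rw [hrt]
      set t := |z| ^ q
      have h3 : (z - c) * ((u z - u c) * u' z) ≤ B * C * (z - c) ^ 2 * (1 + t) ^ 2 := by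
        calc _ ≤ |(z - c) * ((u z - u c) * u' z)| := le_abs_self _
          _ = |z - c| * (|u z - u c| * |u' z|) := by simp only [abs_mul]
          _ ≤ |z - c| * ((B * (1 + t) * |z - c|) * (C * (1 + t))) := by gcongr
          _ = B * C * |z - c| ^ 2 * (1 + t) ^ 2 := by ring
          _ = _ := by rw [sq_abs]
      have h4 : 0 ≤ B * C * (z - c) ^ 2 * (1 - t) ^ 2 := by positivity
      nlinarith
  refine ⟨8 * B * C + 2 * u c ^ 2 + 1, by positivity, fun z => ?_⟩
  have h1 := key z
  have h2 := integral_mul_one_add_abs_add_rpow_nonneg hr0 c z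
  set I := ∫ w in (0:ℝ)..(z - c), w * (1 + |w + c| ^ r)
  have h3 : 0 ≤ u c ^ 2 * I := by positivity
  have h4 : 0 ≤ B * C := by positivity
  nlinarith [sq_nonneg (u z - 2 * u c)]

lemma continuous_div_one_add_abs_add_rpow {q j : ℝ} (hq : 0 ≤ q) (hj : 0 ≤ j) (c : ℝ) :
    Continuous fun w : ℝ => w / ((1 + |w + c| ^ q) * (1 + |w + c| ^ q + j)) :=
  continuous_id.div
    ((continuous_one_add_abs_add_rpow hq c).mul
      ((continuous_one_add_abs_add_rpow hq c).add continuous_const))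
    fun w => by positivity

lemma exists_integral_le_sq {f f' : ℝ → ℝ} {C D a q j : ℝ} (ha : 0 ≤ a) (hq : 0 ≤ q) (hj : 0 ≤ j)
    (hC : 0 ≤ C) (hD : 0 ≤ D)
    (hf : ∀ x, HasDerivAt f (f' x) x) (h : ∀ x, |f' x| ≤ C * (1 + |x| ^ a))
    (hfa : ∀ x, 1 + |x| ^ a ≤ D * (1 + |f x| ^ q)) (c : ℝ) :
    ∃ K, 0 < K ∧ ∀ x,
      ∫ w in (0:ℝ)..(f x - c), w / ((1 + |w + c| ^ q) * (1 + |w + c| ^ q + j))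
        ≤ K * (1 + x ^ 2) := by
  have hk := continuous_div_one_add_abs_add_rpow hq hj c
  set k : ℝ → ℝ := fun w => w / ((1 + |w + c| ^ q) * (1 + |w + c| ^ q + j)) with hkdef
  have hd : ∀ x, HasDerivAt (fun x => ∫ w in (0:ℝ)..(f x - c), k w)
      (k (f x - c) * f' x) x := fun x =>
    (hasDerivAt_integral_zero_sub hk c (f x)).comp x (hf x)
  set A := |f 0| + |c| + C * (1 + |(0:ℝ)| ^ a) with hA
  have hA0 : 0 ≤ A := by positivity
  have hbound : ∀ x, |k (f x - c) * f' x| ≤ A * D * (C * D) * (1 + |x| ^ (1:ℝ)) := by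
    intro x
    have h1 := abs_sub_le_of_abs_deriv_le_rpow ha hC hf h 0 x
    rw [sub_zero] at h1
    have h2 : |f x - c| ≤ A * (1 + |x|) * (1 + |x| ^ a) := by
      have h3 : |f x - c| ≤ |f x - f 0| + (|f 0| + |c|) := by
        calc |f x - c| = |(f x - f 0) + (f 0 - c)| := by ring_nf
          _ ≤ |f x - f 0| + |f 0 - c| := abs_add_le _ _
          _ ≤ _ := by gcongr; exact abs_sub _ _
      have h4 : 0 ≤ |x| ^ a := by positivity
      have h5 : |f 0| + |c| ≤ (|f 0| + |c|) * ((1 + |x|) * (1 + |x| ^ a)) :=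
        le_mul_of_one_le_right (by positivity) (by nlinarith [abs_nonneg x])
      have h6 : C * (1 + |(0:ℝ)| ^ a) * (1 + |x| ^ a) * |x| ≤
          C * (1 + |(0:ℝ)| ^ a) * (1 + |x| ^ a) * (1 + |x|) := by
        gcongr; linarith
      rw [hA]
      linarith
    have hT : 0 < 1 + |f x| ^ q := by positivity
    have hk' : |k (f x - c)| =
        |f x - c| / ((1 + |f x| ^ q) * (1 + |f x| ^ q + j)) := by
      simp only [hkdef, sub_add_cancel]
      rw [abs_div, abs_of_pos (a := (1 + |f x| ^ q) * (1 + |f x| ^ q + j)) (by positivity)]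
    rw [abs_mul, hk', Real.rpow_one, div_mul_eq_mul_div, div_le_iff₀ (by positivity)]
    calc |f x - c| * |f' x|
        ≤ (A * (1 + |x|) * (1 + |x| ^ a)) * (C * (1 + |x| ^ a)) := by gcongr; exact h x
      _ ≤ (A * (1 + |x|) * (D * (1 + |f x| ^ q))) * (C * (D * (1 + |f x| ^ q))) := by
          have := hfa x
          gcongr
      _ = A * D * (C * D) * (1 + |x|) * ((1 + |f x| ^ q) * (1 + |f x| ^ q)) := by ring
      _ ≤ _ := mul_le_mul_of_nonneg_left
          (mul_le_mul_of_nonneg_left (le_add_of_nonneg_right hj) hT.le) (by positivity)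
  set M := A * D * (C * D)
  have hM : 0 ≤ M := by positivity
  refine ⟨|∫ w in (0:ℝ)..(f 0 - c), k w| + 2 * M + 1, by positivity, fun x => ?_⟩
  have h1 := abs_sub_le_of_abs_deriv_le_rpow zero_le_one hM hd hbound 0 x
  simp only [Real.rpow_one, abs_zero, sub_zero, add_zero, mul_one] at h1
  have h2 := (le_abs_self _).trans h1
  have h3 := le_abs_self (∫ w in (0:ℝ)..(f 0 - c), k w)
  set J := |∫ w in (0:ℝ)..(f 0 - c), k w|
  have h4 : 0 ≤ J := abs_nonneg _
  have h5 : |x| ^ 2 = x ^ 2 := sq_abs x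
  have h6 : 0 ≤ M * (1 - |x|) ^ 2 := by positivity
  have h7 : 0 ≤ J * x ^ 2 := by positivity
  have h8 : 0 ≤ M * x ^ 2 := by positivity
  nlinarith

lemma map_withDensity_eq_of_inverse {f u u' : ℝ → ℝ} (hf : Measurable f)
    (hfu : Function.LeftInverse f u) (huf : Function.RightInverse f u)
    (hu : ∀ z, HasDerivAt u (u' z) z) (p : ℝ → ENNReal) :
    Measure.map f (volume.withDensity p) =
      volume.withDensity fun z => ENNReal.ofReal |u' z| * p (u z) := by
  ext B hB
  rw [Measure.map_apply hf hB, withDensity_apply _ (hf hB), withDensity_apply _ hB,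
    ← Set.image_eq_preimage_of_inverse hfu huf]
  exact lintegral_image_eq_lintegral_abs_deriv_mul hB (fun z _ => (hu z).hasDerivWithinAt)
    hfu.injective.injOn p

lemma integrable_gaussianReal_of_abs_le_rpow {g : ℝ → ℝ} {C q : ℝ} (hq : 0 ≤ q) (hg : Measurable g)
    (h : ∀ x, |g x| ≤ C * (1 + |x| ^ q)) (m : ℝ) (ι : NNReal) :
    Integrable g (gaussianReal m ι) := by
  obtain ⟨n, hn⟩ := exists_nat_gt (max q 0)
  have hn0 : n ≠ 0 := by
    rintro rfl
    simp at hn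
  have hint : Integrable (fun x : ℝ => |C| * (2 + |x| ^ n)) (gaussianReal m ι) := by
    have h1 := (memLp_id_gaussianReal (μ := m) (v := ι) (n : NNReal))
    have h2 := MemLp.integrable_norm_pow (p := n) (by simpa using h1) hn0
    exact ((integrable_const _).add h2).const_mul _
  refine hint.mono' hg.aestronglyMeasurable (Filter.Eventually.of_forall fun x => ?_)
  have hx : |x| ^ q ≤ 1 + |x| ^ n := by
    rcases le_total |x| 1 with h1 | h1
    · exact (Real.rpow_le_one (abs_nonneg x) h1 hq).trans (le_add_of_nonneg_right (by positivity))
    · have h2 := Real.rpow_le_rpow_of_exponent_le h1 ((le_max_left q 0).trans hn.le)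
      rw [Real.rpow_natCast] at h2
      linarith
  calc ‖g x‖ ≤ C * (1 + |x| ^ q) := h x
    _ ≤ |C| * (1 + |x| ^ q) := by gcongr; exact le_abs_self C
    _ ≤ |C| * (2 + |x| ^ n) := by gcongr |C| * ?_; linarith

lemma aemeasurable_of_map_eq_gaussianReal {Ω : Type*} [MeasurableSpace Ω] {P : Measure Ω}
    {G : Ω → ℝ} {m : ℝ} {ι : NNReal} (hG : Measure.map G P = gaussianReal m ι) :
    AEMeasurable G P :=
  AEMeasurable.of_map_ne_zero (hG ▸ IsProbabilityMeasure.ne_zero _)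

/-- A function whose derivative has polynomial growth has polynomial growth. -/
lemma abs_le_of_abs_deriv_le_rpow {f f' : ℝ → ℝ} {C q : ℝ} (hq : 0 ≤ q) (hC : 0 ≤ C)
    (hf : ∀ z, HasDerivAt f (f' z) z) (h : ∀ z, |f' z| ≤ C * (1 + |z| ^ q)) (x : ℝ) :
    |f x| ≤ (|f 0| + 2 * (C * (1 + |(0:ℝ)| ^ q))) * (1 + |x| ^ (q + 1)) := by
  have h1 := abs_sub_le_of_abs_deriv_le_rpow hq hC hf h 0 x
  rw [sub_zero] at h1
  have h2 : |x| ^ (q + 1) = |x| ^ q * |x| := Real.rpow_add_one' (abs_nonneg x) (by positivity)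
  have h3 : |x| ≤ 1 + |x| ^ (q + 1) := by
    rcases le_total |x| 1 with h4 | h4
    · exact h4.trans (le_add_of_nonneg_right (by positivity))
    · have := Real.self_le_rpow_of_one_le h4 (le_add_of_nonneg_left hq)
      linarith
  have h5 : 0 ≤ |x| ^ (q + 1) := by positivity
  have h6 : |f x| ≤ |f 0| + |f x - f 0| := by
    simpa using abs_add_le (f 0) (f x - f 0)
  have h7 : 0 ≤ |f 0| * |x| ^ (q + 1) := by positivity
  have h8 : (1 + |x| ^ q) * |x| ≤ 2 * (1 + |x| ^ (q + 1)) := by linarith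
  have h9 : C * (1 + |(0:ℝ)| ^ q) * ((1 + |x| ^ q) * |x|) ≤
      C * (1 + |(0:ℝ)| ^ q) * (2 * (1 + |x| ^ (q + 1))) := by gcongr
  linarith

lemma exp_neg_sq_le {x m v I K : ℝ} (hv : 0 < v) (hK : 0 < K) (h : I ≤ K * (1 + x ^ 2)) :
    Real.exp (-(x - m) ^ 2 / (2 * v)) ≤
      Real.exp ((1 + 2 * m ^ 2) / (4 * v)) * Real.exp (-(1 / (4 * v * K)) * I) := by
  rw [← Real.exp_add]
  refine Real.exp_le_exp.2 ?_
  rw [← sub_nonneg]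
  have : (1 + 2 * m ^ 2) / (4 * v) + -(1 / (4 * v * K)) * I - -(x - m) ^ 2 / (2 * v) =
    (K * (1 + x ^ 2) - I + K * (x - 2 * m) ^ 2) / (4 * v * K) := by
    field_simp
    ring
  rw [this]
  have := sub_nonneg.2 h
  positivity

lemma le_exp_neg_sq {x m v I K : ℝ} (hv : 0 < v) (h : x ^ 2 ≤ K * (1 + I)) :
    Real.exp (-(m ^ 2 + K) / v) * Real.exp (-(K / v) * I) ≤
      Real.exp (-(x - m) ^ 2 / (2 * v)) := by
  rw [← Real.exp_add]
  refine Real.exp_le_exp.2 ?_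
  rw [← sub_nonneg]
  have : -(x - m) ^ 2 / (2 * v) - (-(m ^ 2 + K) / v + -(K / v) * I) =
    (2 * (K * (1 + I) - x ^ 2) + (x + m) ^ 2) / (2 * v) := by
    field_simp
    ring
  rw [this]
  have := sub_nonneg.2 h
  positivity

lemma integral_abs_sub_pos_of_map_eq_withDensity {Ω : Type*} [MeasurableSpace Ω] {P : Measure Ω}
    [IsProbabilityMeasure P] {Z : Ω → ℝ} (hZ : Integrable Z P) {p : ℝ → ENNReal}
    (hp : Measure.map Z P = volume.withDensity p) (c : ℝ) : 0 < ∫ ω, |Z ω - c| ∂P := by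
  refine (integral_nonneg fun ω => abs_nonneg _).lt_of_ne fun h0 => ?_
  have hae := (integral_eq_zero_iff_of_nonneg (fun ω => abs_nonneg (Z ω - c))
    (hZ.sub (integrable_const c)).abs).1 h0.symm
  have hconst : Z =ᵐ[P] fun _ => c := by
    filter_upwards [hae] with ω hω
    exact sub_eq_zero.1 (abs_eq_zero.1 hω)
  have h1 : Measure.map Z P {c} = 1 := by
    rw [Measure.map_congr hconst, Measure.map_const]
    simp
  rw [hp, withDensity_absolutelyContinuous volume p Real.volume_singleton] at h1
  exact zero_ne_one h1

lemma exists_div_mul_le {M σ B α : ℝ} (hM : 0 < M) (hσ : 0 < σ) (hB : 0 < B) (hα : 0 < α) :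
    ∃ K, 0 < K ∧ M / (K * σ) ≤ B ∧ 1 / (K * σ) ≤ α := by
  have h : (M / (B * σ) + 1 / (α * σ)) * σ = M / B + 1 / α := by field_simp
  refine ⟨M / (B * σ) + 1 / (α * σ), by positivity, ?_, ?_⟩
  · rw [h, div_le_iff₀ (by positivity), mul_add, mul_div_cancel₀ _ hB.ne']
    exact le_add_of_nonneg_right (by positivity)
  · rw [h, div_le_iff₀ (by positivity), mul_add, mul_div_cancel₀ _ hα.ne']
    exact le_add_of_nonneg_left (by positivity)

lemma exists_le_div_mul {M σ A δ : ℝ} (hM : 0 < M) (hσ : 0 < σ) (hA : 0 < A) (hδ : 0 < δ) :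
    ∃ K, 0 < K ∧ A ≤ M / (K * σ) ∧ δ ≤ 1 / (K * σ) := by
  refine ⟨1 / ((A / M + δ) * σ), by positivity, ?_, ?_⟩
  · have h : M / (1 / ((A / M + δ) * σ) * σ) = A + M * δ := by field_simp
    rw [h]
    exact le_add_of_nonneg_right (by positivity)
  · have h : 1 / (1 / ((A / M + δ) * σ) * σ) = A / M + δ := by field_simp
    rw [h]
    exact le_add_of_nonneg_left (by positivity)

/-- Theorem 4.2: non-Gaussian two-sided density bounds for `Z = s • v(G)` with `G` Gaussian. -/
theorem stmt_1 {Ω : Type*} [MeasurableSpace Ω] (P : Measure Ω) [IsProbabilityMeasure P]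
    (ι : ℝ) (hι : 0 < ι) (mbar : ℝ) (s : ℝ) (hs : s ≠ 0)
    (G : Ω → ℝ) (hG : Measure.map G P = gaussianReal mbar ⟨ι, hι.le⟩)
    (v : ℝ → ℝ) (hv : ContDiff ℝ 1 v) (hmono : StrictMono v)
    (hbij : Function.Bijective v)
    (a b C₁ C₂ L lam : ℝ) (ha : 0 ≤ a) (hb : 0 < b) (hC₁ : 0 < C₁) (hC₂ : 0 < C₂)
    (hL : 0 < L) (hlam : 0 < lam)
    (hvpos : ∀ x : ℝ, 0 < deriv v x)
    (hvup : ∀ x : ℝ, deriv v x ≤ C₁ * (1 + |x| ^ a))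
    (hinv : ∀ x : ℝ, |Function.invFun v x| ≤ C₂ * (1 + |x| ^ b))
    (hvlow : ∀ x : ℝ, 1 / (L * (1 + |x| ^ lam)) ≤ deriv v x)
    (Z : Ω → ℝ) (hZ : Z = fun ω => s * v (G ω))
    (ν : ℝ) (hν : ν = ∫ ω, Z ω ∂P) :
    ∃ (ρZ : ℝ → ℝ) (K₁ K₂ : ℝ), 0 < K₁ ∧ 0 < K₂ ∧
      Measure.map Z P = volume.withDensity (fun z => ENNReal.ofReal (ρZ z)) ∧
      ∀ᵐ z ∂(volume : Measure ℝ),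
        (∫ ω, |Z ω - ν| ∂P) /
            (K₁ * s ^ 2 * ι * (1 + |z| ^ (a * b)) * (1 + |z| ^ (a * b) + ι ^ (a / 2))) *
            Real.exp (-(1 / (K₂ * s ^ 2 * ι)) *
              ∫ w in (0:ℝ)..(z - ν), w * (1 + |w + ν| ^ (2 * lam * b))) ≤ ρZ z ∧
        ρZ z ≤ (∫ ω, |Z ω - ν| ∂P) / (K₂ * s ^ 2 * ι) * (1 + |z| ^ (2 * lam * b)) *
            Real.exp (-(1 / (K₁ * s ^ 2 * ι)) *
              ∫ w in (0:ℝ)..(z - ν),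
                w / ((1 + |w + ν| ^ (a * b)) * (1 + |w + ν| ^ (a * b) + ι ^ (a / 2)))) := by
  have hvd : ∀ x, HasDerivAt v (deriv v x) x := fun x =>
    (hv.differentiable one_ne_zero x).hasDerivAt
  have hs0 : 0 < |s| := abs_pos.2 hs
  have hι0 : (⟨ι, hι.le⟩ : NNReal) ≠ 0 := fun h => hι.ne' (congrArg NNReal.toReal h)
  have hvw : ∀ y, v (Function.invFun v y) = y := Function.rightInverse_invFun hbij.2
  have hwv : ∀ x, Function.invFun v (v x) = x := Function.leftInverse_invFun hbij.1
  have hwmono : Monotone (Function.invFun v) := fun x y hxy => by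
    rwa [← hmono.le_iff_le, hvw, hvw]
  have hwcont : Continuous (Function.invFun v) :=
    hwmono.continuous_of_surjective fun x => ⟨v x, hwv x⟩
  set f : ℝ → ℝ := fun x => s * v x with hfdef
  set u : ℝ → ℝ := fun z => Function.invFun v (z / s) with hudef
  set u' : ℝ → ℝ := fun z => (s * deriv v (u z))⁻¹ with hu'def
  have hfu : Function.LeftInverse f u := fun z => by
    simp only [hfdef, hudef, hvw]
    field_simp
  have huf : Function.RightInverse f u := fun x => by
    simp only [hfdef, hudef]
    rw [mul_div_cancel_left₀ _ hs, hwv]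
  have hf : ∀ x, HasDerivAt f (s * deriv v x) x := fun x => (hvd x).const_mul s
  have hfcont : Continuous f := continuous_const.mul hv.continuous
  have hu : ∀ z, HasDerivAt u (u' z) z := fun z =>
    HasDerivAt.of_local_left_inverse
      (hwcont.comp (continuous_id.div_const s)).continuousAt (hf (u z))
      (mul_ne_zero hs (hvpos _).ne') (Filter.Eventually.of_forall hfu)
  have hfbound : ∀ x, |s * deriv v x| ≤ |s| * C₁ * (1 + |x| ^ a) := fun x => by
    rw [abs_mul, abs_of_pos (hvpos x), mul_assoc]
    gcongr
    exact hvup x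
  have hubound : ∀ z, |u z| ≤ C₂ * (1 + (|s| ^ b)⁻¹) * (1 + |z| ^ b) := fun z => by
    refine (hinv (z / s)).trans ?_
    rw [abs_div, Real.div_rpow (abs_nonneg z) hs0.le, mul_assoc]
    gcongr
    have h1 : 0 ≤ |z| ^ b := by positivity
    have h2 : 0 ≤ (|s| ^ b)⁻¹ := by positivity
    rw [div_eq_mul_inv]
    nlinarith
  obtain ⟨Da, hDa, hDau⟩ := exists_one_add_rpow_le (b := b) ha
    (show 0 ≤ C₂ * (1 + (|s| ^ b)⁻¹) by positivity)
  obtain ⟨Dl, hDl, hDlu⟩ := exists_one_add_rpow_le (b := b) hlam.le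
    (show 0 ≤ C₂ * (1 + (|s| ^ b)⁻¹) by positivity)
  have hu'abs : ∀ z, |u' z| = |s|⁻¹ * (deriv v (u z))⁻¹ := fun z => by
    simp only [hu'def, abs_inv, abs_mul, mul_inv, abs_of_pos (hvpos (u z))]
  have hu'up : ∀ z, |u' z| ≤ |s|⁻¹ * (L * Dl) * (1 + |z| ^ (lam * b)) := fun z => by
    rw [hu'abs, mul_assoc]
    gcongr
    have h1 := inv_anti₀ (by positivity) (hvlow (u z))
    rw [one_div, inv_inv] at h1
    refine h1.trans ?_
    rw [mul_assoc]
    gcongr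
    exact hDlu _ _ (hubound z)
  have hu'low : ∀ z, (|s| * C₁ * Da)⁻¹ / (1 + |z| ^ (a * b)) ≤ |u' z| := fun z => by
    have h1 : deriv v (u z) ≤ C₁ * (Da * (1 + |z| ^ (a * b))) :=
      (hvup _).trans (mul_le_mul_of_nonneg_left (hDau _ _ (hubound z)) hC₁.le)
    have h2 := inv_anti₀ (hvpos _) h1
    rw [hu'abs]
    calc _ = |s|⁻¹ * (C₁ * (Da * (1 + |z| ^ (a * b))))⁻¹ := by
          field_simp
      _ ≤ _ := by gcongr
  have hGm : AEMeasurable G P := aemeasurable_of_map_eq_gaussianReal hG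
  have hlaw : Measure.map Z P = volume.withDensity fun z =>
      ENNReal.ofReal (|u' z| * gaussianPDFReal mbar ⟨ι, hι.le⟩ (u z)) := by
    have h1 : Measure.map Z P = Measure.map f (gaussianReal mbar ⟨ι, hι.le⟩) := by
      rw [← hG, AEMeasurable.map_map_of_aemeasurable hfcont.measurable.aemeasurable hGm, hZ]
      rfl
    rw [h1, gaussianReal_of_var_ne_zero _ hι0,
      map_withDensity_eq_of_inverse hfcont.measurable hfu huf hu]
    simp only [gaussianPDF, ENNReal.ofReal_mul (abs_nonneg _)]
  have hZint : Integrable Z P := by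
    have h1 : Integrable f (gaussianReal mbar ⟨ι, hι.le⟩) :=
      integrable_gaussianReal_of_abs_le_rpow (by positivity) hfcont.measurable
        (abs_le_of_abs_deriv_le_rpow ha (by positivity) hf hfbound) _ _
    rw [← hG, integrable_map_measure hfcont.aestronglyMeasurable hGm] at h1
    rw [hZ]
    exact h1
  have hM := integral_abs_sub_pos_of_map_eq_withDensity hZint hlaw ν
  obtain ⟨Kl, hKl, hlow⟩ := exists_sq_le_integral (r := 2 * lam * b) (by positivity)
    (by positivity) (by ring) hu hu'up ν
  have hab : 0 ≤ a * b := by positivity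
  have hj : 0 ≤ ι ^ (a / 2) := by positivity
  obtain ⟨Ku, hKu, hup⟩ := exists_integral_le_sq ha hab hj (by positivity) hDa.le hf hfbound
    (fun x => by
      have := hDau _ _ (hubound (f x))
      rwa [huf x] at this) ν
  set M := ∫ ω, |Z ω - ν| ∂P
  set g := (√(2 * Real.pi * ι))⁻¹
  have hg0 : 0 < g := by positivity
  obtain ⟨A, hA, hAeq⟩ : ∃ A, 0 < A ∧ A = 2 * (|s|⁻¹ * (L * Dl)) * g *
      Real.exp ((1 + 2 * mbar ^ 2) / (4 * ι)) := ⟨_, by positivity, rfl⟩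
  obtain ⟨B, hB, hBeq⟩ : ∃ B, 0 < B ∧ B = (|s| * C₁ * Da)⁻¹ * g *
      Real.exp (-(mbar ^ 2 + Kl) / ι) := ⟨_, by positivity, rfl⟩
  have hσ : 0 < s ^ 2 * ι := by positivity
  set σ := s ^ 2 * ι with hσdef
  set α := 1 / (4 * ι * Ku)
  have hα0 : 0 < α := by positivity
  set δ := Kl / ι
  have hδ0 : 0 < δ := by positivity
  obtain ⟨K₁, hK₁, hK₁B, hK₁α⟩ := exists_div_mul_le hM hσ hB hα0
  obtain ⟨K₂, hK₂, hK₂A, hK₂δ⟩ := exists_le_div_mul hM hσ hA hδ0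
  refine ⟨_, K₁, K₂, hK₁, hK₂, hlaw, Filter.Eventually.of_forall fun z => ?_⟩
  simp only [mul_assoc _ (s ^ 2) ι, ← hσdef]
  have hpdf : gaussianPDFReal mbar ⟨ι, hι.le⟩ (u z) =
      g * Real.exp (-(u z - mbar) ^ 2 / (2 * ι)) := rfl
  rw [hpdf]
  have hI₂ : 0 ≤ ∫ w in (0:ℝ)..(z - ν), w * (1 + |w + ν| ^ (2 * lam * b)) :=
    integral_mul_one_add_abs_add_rpow_nonneg (by positivity) ν z
  have hI₁ : 0 ≤ ∫ w in (0:ℝ)..(z - ν),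
      w / ((1 + |w + ν| ^ (a * b)) * (1 + |w + ν| ^ (a * b) + ι ^ (a / 2))) :=
    integral_zero_sub_nonneg (continuous_div_one_add_abs_add_rpow hab hj ν)
      (fun w => by rw [← mul_div_assoc]; exact div_nonneg (mul_self_nonneg w) (by positivity)) ν z
  have hlow' := le_exp_neg_sq (m := mbar) hι (hlow z)
  have hup' := exp_neg_sq_le (m := mbar) hι hKu (hup (u z))
  rw [hfu z] at hup'
  set I₁ := ∫ w in (0:ℝ)..(z - ν),
      w / ((1 + |w + ν| ^ (a * b)) * (1 + |w + ν| ^ (a * b) + ι ^ (a / 2)))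
  set I₂ := ∫ w in (0:ℝ)..(z - ν), w * (1 + |w + ν| ^ (2 * lam * b))
  set T := |z| ^ (a * b)
  have hT0 : 0 ≤ T := by positivity
  constructor
  · calc _ = M / (K₁ * σ) / ((1 + T) * (1 + T + ι ^ (a / 2))) *
          Real.exp (-(1 / (K₂ * σ)) * I₂) := by
          rw [div_div]; ring_nf
      _ ≤ B / (1 + T) * Real.exp (-δ * I₂) := by
          gcongr
          exact le_mul_of_one_le_right (by positivity) (by linarith)
      _ = (|s| * C₁ * Da)⁻¹ / (1 + T) *
          (g * (Real.exp (-(mbar ^ 2 + Kl) / ι) * Real.exp (-δ * I₂))) := by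
          rw [hBeq]; ring
      _ ≤ _ := by
          gcongr
          exact hu'low z
  · have hR : |z| ^ (2 * lam * b) = (|z| ^ (lam * b)) ^ 2 := by
      rw [← Real.rpow_mul_natCast (abs_nonneg z)]
      congr 1
      push_cast
      ring
    calc _ ≤ (|s|⁻¹ * (L * Dl) * (1 + |z| ^ (lam * b))) *
          (g * (Real.exp ((1 + 2 * mbar ^ 2) / (4 * ι)) * Real.exp (-α * I₁))) := by
          gcongr
          exact hu'up z
      _ ≤ (|s|⁻¹ * (L * Dl) * (2 * (1 + |z| ^ (2 * lam * b)))) *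
          (g * (Real.exp ((1 + 2 * mbar ^ 2) / (4 * ι)) * Real.exp (-α * I₁))) := by
          gcongr
          rw [hR]
          nlinarith [sq_nonneg (|z| ^ (lam * b) - 1)]
      _ = A * (1 + |z| ^ (2 * lam * b)) * Real.exp (-α * I₁) := by
          rw [hAeq]; ring
      _ ≤ _ := by gcongr
end

section
/- Let a > 0, ι > 0, s ∈ ℝ with s ≠ 0, A ∈ ℝ, and let h : ℝ → ℝ be twice continuously differentiable with 0 < c̃ ≤ h″(x) ≤ C̃ for all x ∈ ℝ, for constants c̃, C̃. For t > 0 and suitable g : ℝ → ℝ define (P_t g)(x) := ∫_ℝ g(y) (2πt)^{−1/2} exp(−(x−y)²/(2t)) dy. Let G be a real random variable whose law is the centered Gaussian law on ℝ with variance ι, and set Z := s·(P_a h′)(A+G). Then the law of Z is absolutely continuous with respect to Lebesgue measure with a density p satisfying, for almost every x ∈ ℝ: (E|Z−E Z|/(2C̃²s²ι)) · exp(−(x−E Z)²/(2c̃²s²ι)) ≤ p(x) ≤ (E|Z−E Z|/(2c̃²s²ι)) · exp(−(x−E Z)²/(2C̃²s²ι)). -/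
open MeasureTheory ProbabilityTheory

/-- The Gaussian (heat) semigroup kernel applied to `g`:
`(P_t g)(x) = ∫ g(y) (2πt)^{-1/2} exp(-(x-y)²/(2t)) dy`. -/
noncomputable def heatP (t : ℝ) (g : ℝ → ℝ) (x : ℝ) : ℝ :=
  ∫ y : ℝ, g y * ((2 * Real.pi * t) ^ (-(1:ℝ) / 2) * Real.exp (-(x - y) ^ 2 / (2 * t)))

open scoped NNReal

/-- The heat semigroup is the convolution with a centered Gaussian law. -/
lemma heatP_eq_integral_gaussianReal {v : ℝ≥0} (hv : v ≠ 0) (g : ℝ → ℝ) (x : ℝ) :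
    heatP v g x = ∫ z, g (x + z) ∂gaussianReal 0 v := by
  rw [integral_gaussianReal_eq_integral_smul hv,
    ← integral_sub_right_eq_self _ x]
  refine integral_congr_ae (ae_of_all _ fun y => ?_)
  have h1 : (2 * Real.pi * (v : ℝ)) ^ (-(1 : ℝ) / 2) = (√(2 * Real.pi * v))⁻¹ := by
    rw [Real.sqrt_eq_rpow, ← Real.rpow_neg (by positivity)]
    congr 1
    norm_num
  have h2 : (x - y) ^ 2 = (y - x) ^ 2 := by ring
  simp only [gaussianPDFReal, smul_eq_mul, sub_zero, add_sub_cancel, h1, h2]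
  ring

lemma integrable_of_hasDerivAt_le_gaussianReal {v : ℝ≥0} {F F' : ℝ → ℝ} {C : ℝ}
    (hF : ∀ u, HasDerivAt F (F' u) u) (hC : ∀ u, |F' u| ≤ C) :
    Integrable F (gaussianReal 0 v) := by
  have hcont : Continuous F := continuous_iff_continuousAt.2 fun u => (hF u).continuousAt
  have hid : Integrable (fun x : ℝ => x) (gaussianReal 0 v) :=
    (memLp_id_gaussianReal 1).integrable le_rfl
  refine ((integrable_const |F 0|).add (hid.abs.const_mul C)).mono'
    hcont.aestronglyMeasurable (ae_of_all _ fun u => ?_)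
  have h1 := convex_univ.norm_image_sub_le_of_norm_hasDerivWithin_le (f := F) (f' := F') (C := C)
    (fun x _ => (hF x).hasDerivWithinAt) (fun x _ => hC x) (Set.mem_univ 0) (Set.mem_univ u)
  simp only [Real.norm_eq_abs, sub_zero, Pi.add_apply] at h1 ⊢
  calc |F u| = |F 0 + (F u - F 0)| := by ring_nf
    _ ≤ |F 0| + |F u - F 0| := abs_add_le _ _
    _ ≤ _ := by linarith

lemma hasDerivAt_integral_add_gaussianReal {v : ℝ≥0} {g g' : ℝ → ℝ} {C : ℝ}
    (hg : ∀ u, HasDerivAt g (g' u) u) (hg' : Continuous g') (hC : ∀ u, |g' u| ≤ C) (x : ℝ) :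
    HasDerivAt (fun x => ∫ z, g (x + z) ∂gaussianReal 0 v)
      (∫ z, g' (x + z) ∂gaussianReal 0 v) x := by
  have hcont : Continuous g := continuous_iff_continuousAt.2 fun u => (hg u).continuousAt
  refine (hasDerivAt_integral_of_dominated_loc_of_deriv_le (bound := fun _ => C)
    (F' := fun x z => g' (x + z)) Filter.univ_mem
    (Filter.Eventually.of_forall fun y => ?_) ?_ ?_ ?_ (integrable_const C) ?_).2
  · exact (hcont.comp (continuous_const.add continuous_id)).aestronglyMeasurable
  · exact integrable_of_hasDerivAt_le_gaussianReal (F := fun z => g (x + z))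
      (F' := fun z => g' (x + z)) (C := C) (fun u => (hg (x + u)).comp_const_add x u)
      (fun u => hC _)
  · exact (hg'.comp (continuous_const.add continuous_id)).aestronglyMeasurable
  · exact ae_of_all _ fun z y _ => hC _
  · exact ae_of_all _ fun z y _ => (hg (y + z)).comp_add_const y z

lemma integral_mem_bounds {X : Type*} [MeasurableSpace X] {μ : Measure X} [IsProbabilityMeasure μ]
    {g : X → ℝ} {c C : ℝ} (hgm : AEStronglyMeasurable g μ) (hg : ∀ x, c ≤ g x ∧ g x ≤ C) :
    c ≤ ∫ x, g x ∂μ ∧ ∫ x, g x ∂μ ≤ C := by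
  have hi : Integrable g μ := by
    refine (integrable_const (max |c| |C|)).mono' hgm (ae_of_all _ fun x => ?_)
    exact abs_le_max_abs_abs (hg x).1 (hg x).2
  have h1 := integral_mono (integrable_const c) hi fun x => (hg x).1
  have h2 := integral_mono hi (integrable_const C) fun x => (hg x).2
  simp only [integral_const, probReal_univ, one_smul] at h1 h2
  exact ⟨h1, h2⟩

/-- A centered monotone function has nonnegative integral over every upper half-line. -/
lemma setIntegral_Ioi_nonneg_of_monotone {μ : Measure ℝ} {k : ℝ → ℝ} (hk : Monotone k)
    (hint : Integrable k μ) (h0 : ∫ x, k x ∂μ = 0) (u : ℝ) : 0 ≤ ∫ x in Set.Ioi u, k x ∂μ := by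
  rcases le_total 0 (k u) with hu | hu
  · exact setIntegral_nonneg measurableSet_Ioi fun x hx => hu.trans (hk (le_of_lt hx))
  · have h1 : ∫ x in Set.Iic u, k x ∂μ ≤ 0 :=
      setIntegral_nonpos measurableSet_Iic fun x hx => (hk hx).trans hu
    have h2 := intervalIntegral.integral_Iic_add_Ioi (b := u) hint.integrableOn hint.integrableOn
    linarith

lemma hasDerivAt_gaussianPDFReal {v : ℝ≥0} (hv : v ≠ 0) (u : ℝ) :
    HasDerivAt (gaussianPDFReal 0 v) (-(u / v) * gaussianPDFReal 0 v u) u := by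
  have hv' : (v : ℝ) ≠ 0 := by exact_mod_cast hv
  have h1 : HasDerivAt (fun x : ℝ => -(x - 0) ^ 2 / (2 * (v : ℝ))) (-(u / v)) u := by
    convert! ((((hasDerivAt_id u).sub_const 0).pow 2).neg).div_const (2 * (v : ℝ)) using 1
    simp only [id, sub_zero]
    field_simp
    norm_num [mul_comm]
  convert! (h1.exp).const_mul (√(2 * Real.pi * v))⁻¹ using 1
  simp only [gaussianPDFReal]
  ring

lemma setIntegral_gaussianReal {v : ℝ≥0} (hv : v ≠ 0) {s : Set ℝ} (hs : MeasurableSet s)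
    (k : ℝ → ℝ) :
    ∫ x in s, k x ∂gaussianReal 0 v = ∫ x in s, gaussianPDFReal 0 v x * k x := by
  rw [gaussianReal_of_var_ne_zero _ hv, setIntegral_withDensity_eq_setIntegral_toReal_smul
    (measurable_gaussianPDF _ _) (ae_of_all _ fun _ => gaussianPDF_lt_top) _ hs]
  simp only [toReal_gaussianPDF, smul_eq_mul]

lemma integrable_gaussianPDFReal_mul {v : ℝ≥0} (hv : v ≠ 0) {k : ℝ → ℝ}
    (hk : Integrable k (gaussianReal 0 v)) :
    Integrable (fun x => gaussianPDFReal 0 v x * k x) := by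
  rw [gaussianReal_of_var_ne_zero _ hv, integrable_withDensity_iff_integrable_smul'
    (measurable_gaussianPDF _ _) (ae_of_all _ fun _ => gaussianPDF_lt_top)] at hk
  simpa only [toReal_gaussianPDF, smul_eq_mul] using hk

lemma hasDerivAt_setIntegral_Ioi {k : ℝ → ℝ} (hk : Continuous k) (hint : Integrable k) (u : ℝ) :
    HasDerivAt (fun u => ∫ x in Set.Ioi u, k x) (-k u) u := by
  have h1 : (fun u => ∫ x in Set.Ioi u, k x) =
      fun u => (∫ x in Set.Ioi 0, k x) - ∫ x in (0 : ℝ)..u, k x := by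
    funext u
    have := intervalIntegral.integral_interval_add_Ioi (a := 0) (b := u) (f := k) (μ := volume)
      hint.integrableOn hint.integrableOn
    linarith
  rw [h1]
  exact (intervalIntegral.integral_hasDerivAt_right (hk.intervalIntegrable _ _)
    (hk.stronglyMeasurableAtFilter _ _) hk.continuousAt).const_sub _

lemma tendsto_gaussianPDFReal_atTop {v : ℝ≥0} (hv : v ≠ 0) :
    Filter.Tendsto (gaussianPDFReal 0 v) Filter.atTop (nhds 0) := by
  have hv' : (0 : ℝ) < v := by exact_mod_cast pos_iff_ne_zero.2 hv
  have h1 : Filter.Tendsto (fun x : ℝ => -(x - 0) ^ 2 / (2 * (v : ℝ))) Filter.atTop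
      Filter.atBot := by
    simp only [sub_zero]
    exact (Filter.tendsto_neg_atTop_atBot.comp
      (Filter.tendsto_pow_atTop two_ne_zero)).atBot_div_const (by positivity)
  simpa [gaussianPDFReal_def, Function.comp_def] using
    (Real.tendsto_exp_atBot.comp h1).const_mul (√(2 * Real.pi * v))⁻¹

lemma setIntegral_Ioi_id_gaussianReal {v : ℝ≥0} (hv : v ≠ 0) (u : ℝ) :
    ∫ x in Set.Ioi u, x ∂gaussianReal 0 v = v * gaussianPDFReal 0 v u := by
  have hv' : (v : ℝ) ≠ 0 := by exact_mod_cast hv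
  have hid : Integrable (fun x : ℝ => x) (gaussianReal 0 v) :=
    (memLp_id_gaussianReal 1).integrable le_rfl
  rw [setIntegral_gaussianReal hv measurableSet_Ioi]
  have h1 := integral_Ioi_of_hasDerivAt_of_tendsto' (a := u)
    (f := fun x => -(v : ℝ) * gaussianPDFReal 0 v x)
    (f' := fun x => gaussianPDFReal 0 v x * x) (m := -(v : ℝ) * 0)
    (fun x _ => by
      convert! (hasDerivAt_gaussianPDFReal hv x).const_mul (-(v : ℝ)) using 1
      field_simp)
    (integrable_gaussianPDFReal_mul hv hid).integrableOn
    ((tendsto_gaussianPDFReal_atTop hv).const_mul _)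
  rw [h1]
  ring

/-- Comparison of the truncated first moment of `F` with the one of the identity. -/
lemma setIntegral_Ioi_gaussianReal_bounds {v : ℝ≥0} (hv : v ≠ 0) {F F' : ℝ → ℝ} {c C : ℝ}
    (hF : ∀ u, HasDerivAt F (F' u) u) (hF' : ∀ u, c ≤ F' u ∧ F' u ≤ C)
    (hint : Integrable F (gaussianReal 0 v)) {m : ℝ} (hm : m = ∫ x, F x ∂gaussianReal 0 v)
    (u : ℝ) :
    c * (v * gaussianPDFReal 0 v u) ≤ ∫ x in Set.Ioi u, (F x - m) ∂gaussianReal 0 v ∧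
      ∫ x in Set.Ioi u, (F x - m) ∂gaussianReal 0 v ≤ C * (v * gaussianPDFReal 0 v u) := by
  have hid : Integrable (fun x : ℝ => x) (gaussianReal 0 v) :=
    (memLp_id_gaussianReal 1).integrable le_rfl
  have hFm : Integrable (fun x => F x - m) (gaussianReal 0 v) := hint.sub (integrable_const m)
  have hFm0 : ∫ x, (F x - m) ∂gaussianReal 0 v = 0 := by
    rw [integral_sub hint (integrable_const m)]
    simp [hm]
  have hcent (b : ℝ) : ∫ x, b * x ∂gaussianReal 0 v = 0 := by
    rw [integral_const_mul, integral_id_gaussianReal, mul_zero]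
  have htail (b : ℝ) :
      ∫ x in Set.Ioi u, b * x ∂gaussianReal 0 v = b * (v * gaussianPDFReal 0 v u) := by
    rw [integral_const_mul, setIntegral_Ioi_id_gaussianReal hv]
  have hd (b x : ℝ) : HasDerivAt (fun y => F y - m - b * y) (F' x - b) x := by
    simpa using ((hF x).sub_const m).fun_sub ((hasDerivAt_id x).const_mul b)
  have hd' (b x : ℝ) : HasDerivAt (fun y => b * y - (F y - m)) (b - F' x) x := by
    simpa using ((hasDerivAt_id x).const_mul b).fun_sub ((hF x).sub_const m)
  constructor
  · have h1 := setIntegral_Ioi_nonneg_of_monotone (μ := gaussianReal 0 v)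
      (monotone_of_hasDerivAt_nonneg (hd c) fun x => sub_nonneg.2 (hF' x).1)
      (hFm.sub (hid.const_mul c))
      (by rw [integral_sub hFm (hid.const_mul c), hFm0, hcent, sub_zero]) u
    rw [integral_sub hFm.integrableOn (hid.const_mul c).integrableOn, htail] at h1
    linarith
  · have h1 := setIntegral_Ioi_nonneg_of_monotone (μ := gaussianReal 0 v)
      (monotone_of_hasDerivAt_nonneg (hd' C) fun x => sub_nonneg.2 (hF' x).2)
      ((hid.const_mul C).sub hFm)
      (by rw [integral_sub (hid.const_mul C) hFm, hFm0, hcent, sub_zero]) u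
    rw [integral_sub (hid.const_mul C).integrableOn hFm.integrableOn, htail] at h1
    linarith

lemma le_of_hasDerivAt_sign {H H' : ℝ → ℝ} {u₀ : ℝ} (hH : ∀ u, HasDerivAt H (H' u) u)
    (hpos : ∀ u, u₀ ≤ u → 0 ≤ H' u) (hneg : ∀ u, u ≤ u₀ → H' u ≤ 0) (u : ℝ) : H u₀ ≤ H u := by
  have hcont : Continuous H := continuous_iff_continuousAt.2 fun u => (hH u).continuousAt
  rcases le_total u₀ u with hu | hu
  · refine monotoneOn_of_hasDerivWithinAt_nonneg (convex_Ici u₀) hcont.continuousOn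
      (fun x _ => (hH x).hasDerivWithinAt) (fun x hx => hpos x ?_) Set.self_mem_Ici hu hu
    exact Set.mem_Ici.1 (interior_subset hx)
  · refine antitoneOn_of_hasDerivWithinAt_nonpos (convex_Iic u₀) hcont.continuousOn
      (fun x _ => (hH x).hasDerivWithinAt) (fun x hx => hneg x ?_) hu Set.self_mem_Iic hu
    exact Set.mem_Iic.1 (interior_subset hx)

lemma surjective_of_le_hasDerivAt {F F' : ℝ → ℝ} {c : ℝ} (hc : 0 < c)
    (hF : ∀ u, HasDerivAt F (F' u) u) (hF' : ∀ u, c ≤ F' u) : Function.Surjective F := by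
  have hcont : Continuous F := continuous_iff_continuousAt.2 fun u => (hF u).continuousAt
  have hmono : Monotone fun x => F x - c * x :=
    monotone_of_hasDerivAt_nonneg (f' := fun x => F' x - c)
      (fun x => by simpa using (hF x).fun_sub ((hasDerivAt_id x).const_mul c))
      fun x => sub_nonneg.2 (hF' x)
  refine hcont.surjective ?_ ?_
  · refine Filter.tendsto_atTop_mono' _ ?_
      (Filter.tendsto_atTop_add_const_left _ (F 0) (Filter.tendsto_id.const_mul_atTop hc))
    filter_upwards [Filter.eventually_ge_atTop 0] with x hx
    have := hmono hx
    simp only [id] at *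
    linarith
  · refine Filter.tendsto_atBot_mono' _ ?_
      (Filter.tendsto_atBot_add_const_left _ (F 0) (Filter.tendsto_id.const_mul_atBot hc))
    filter_upwards [Filter.eventually_le_atBot 0] with x hx
    have := hmono hx
    simp only [id] at *
    linarith

/-- Change of variables: the law of `F` under a Gaussian measure has density `f / F'` along `F`. -/
lemma map_gaussianReal_eq_withDensity {v : ℝ≥0} (hv : v ≠ 0) {F F' p : ℝ → ℝ}
    (hF : ∀ u, HasDerivAt F (F' u) u) (hF' : ∀ u, 0 < F' u) (hbij : Function.Bijective F)
    (hp : ∀ u, p (F u) = gaussianPDFReal 0 v u / F' u) :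
    Measure.map F (gaussianReal 0 v) = volume.withDensity fun x => ENNReal.ofReal (p x) := by
  have hcont : Continuous F := continuous_iff_continuousAt.2 fun u => (hF u).continuousAt
  ext B hB
  rw [Measure.map_apply hcont.measurable hB, withDensity_apply _ hB, gaussianReal_apply _ hv,
    ← Set.image_preimage_eq B hbij.2,
    lintegral_image_eq_lintegral_abs_deriv_mul (hcont.measurable hB)
      (fun x _ => (hF x).hasDerivWithinAt) hbij.1.injOn, Set.image_preimage_eq B hbij.2]
  refine lintegral_congr fun x => ?_
  rw [hp, ← ENNReal.ofReal_mul (abs_nonneg _), abs_of_pos (hF' x),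
    mul_div_cancel₀ _ (hF' x).ne', gaussianPDF]

/-- Half of the absolute central moment is carried by the upper part. -/
lemma setIntegral_Ioi_eq_half_integral_abs {μ : Measure ℝ} {k : ℝ → ℝ} (hk : Monotone k)
    (hint : Integrable k μ) (h0 : ∫ x, k x ∂μ = 0) {u : ℝ} (hu : k u = 0) :
    ∫ x in Set.Ioi u, k x ∂μ = (∫ x, |k x| ∂μ) / 2 := by
  have h1 := intervalIntegral.integral_Iic_add_Ioi (b := u) hint.integrableOn hint.integrableOn
  have h2 := intervalIntegral.integral_Iic_add_Ioi (b := u) hint.abs.integrableOn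
    hint.abs.integrableOn
  have h3 : ∫ x in Set.Iic u, |k x| ∂μ = ∫ x in Set.Iic u, -k x ∂μ :=
    setIntegral_congr_fun measurableSet_Iic fun x hx => abs_of_nonpos ((hk hx).trans hu.le)
  have h4 : ∫ x in Set.Ioi u, |k x| ∂μ = ∫ x in Set.Ioi u, k x ∂μ :=
    setIntegral_congr_fun measurableSet_Ioi fun x hx => abs_of_nonneg (hu.ge.trans (hk (le_of_lt hx)))
  rw [integral_neg] at h3
  linarith

/-- Two-sided density bounds for an increasing bi-Lipschitz function of a Gaussian variable. -/
theorem exists_density_bounds_gaussianReal {v : ℝ≥0} (hv : v ≠ 0) {F F' : ℝ → ℝ} {c C : ℝ}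
    (hc : 0 < c) (hF : ∀ u, HasDerivAt F (F' u) u) (hF' : ∀ u, c ≤ F' u ∧ F' u ≤ C) {m : ℝ}
    (hm : m = ∫ x, F x ∂gaussianReal 0 v) :
    ∃ p : ℝ → ℝ,
      Measure.map F (gaussianReal 0 v) = volume.withDensity (fun x => ENNReal.ofReal (p x)) ∧
      ∀ x, (∫ y, |F y - m| ∂gaussianReal 0 v) / (2 * C ^ 2 * v) *
            Real.exp (-(x - m) ^ 2 / (2 * c ^ 2 * v)) ≤ p x ∧
        p x ≤ (∫ y, |F y - m| ∂gaussianReal 0 v) / (2 * c ^ 2 * v) *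
            Real.exp (-(x - m) ^ 2 / (2 * C ^ 2 * v)) := by
  have hv' : (0 : ℝ) < v := by exact_mod_cast pos_iff_ne_zero.2 hv
  have hC : 0 < C := hc.trans_le ((hF' 0).1.trans (hF' 0).2)
  have hF'pos (u : ℝ) : 0 < F' u := hc.trans_le (hF' u).1
  have hcont : Continuous F := continuous_iff_continuousAt.2 fun u => (hF u).continuousAt
  have hmono : StrictMono F := strictMono_of_hasDerivAt_pos hF hF'pos
  have hsurj : Function.Surjective F := surjective_of_le_hasDerivAt hc hF fun u => (hF' u).1
  have hint : Integrable F (gaussianReal 0 v) :=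
    integrable_of_hasDerivAt_le_gaussianReal hF
      fun u => (abs_of_pos (hF'pos u)).trans_le (hF' u).2
  have hFm : Integrable (fun x => F x - m) (gaussianReal 0 v) := hint.sub (integrable_const m)
  have hFm0 : ∫ x, (F x - m) ∂gaussianReal 0 v = 0 := by
    rw [integral_sub hint (integrable_const m)]
    simp [hm]
  obtain ⟨u₀, hu₀⟩ := hsurj m
  set f := gaussianPDFReal 0 v
  have hfcont : Continuous f :=
    continuous_iff_continuousAt.2 fun u => (hasDerivAt_gaussianPDFReal hv u).continuousAt
  set Ψ : ℝ → ℝ := fun u => ∫ x in Set.Ioi u, (F x - m) ∂gaussianReal 0 v with hΨ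
  set M := ∫ y, |F y - m| ∂gaussianReal 0 v
  have hΨb (u : ℝ) : c * (v * f u) ≤ Ψ u ∧ Ψ u ≤ C * (v * f u) :=
    setIntegral_Ioi_gaussianReal_bounds hv hF hF' hint hm u
  have hfpos (u : ℝ) : 0 < f u := gaussianPDFReal_pos 0 v u hv
  have hΨpos (u : ℝ) : 0 < Ψ u :=
    (mul_pos hc (mul_pos hv' (hfpos u))).trans_le (hΨb u).1
  have hΨ₀ : Ψ u₀ = M / 2 :=
    setIntegral_Ioi_eq_half_integral_abs
      (fun x y hxy => sub_le_sub_right (hmono.monotone hxy) m) hFm hFm0 (sub_eq_zero.2 hu₀)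
  have hΨd (u : ℝ) : HasDerivAt Ψ (-(f u * (F u - m))) u := by
    simp only [hΨ, setIntegral_gaussianReal hv measurableSet_Ioi]
    exact hasDerivAt_setIntegral_Ioi (hfcont.mul (hcont.sub continuous_const))
      (integrable_gaussianPDFReal_mul hv hFm) u
  have hHd (b : ℝ) (hb : 0 < b) (u : ℝ) :
      HasDerivAt (fun u => Ψ u * Real.exp ((F u - m) ^ 2 / (2 * b ^ 2 * v)))
        ((F u - m) * (Real.exp ((F u - m) ^ 2 / (2 * b ^ 2 * v)) *
          (Ψ u * F' u / (b ^ 2 * v) - f u))) u := by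
    convert! (hΨd u).mul
      (((((hF u).sub_const m).pow 2).div_const (2 * b ^ 2 * (v : ℝ))).exp) using 1
    simp only [Pi.pow_apply]
    field_simp
    push_cast
    ring
  have hupper (u : ℝ) : Ψ u * Real.exp ((F u - m) ^ 2 / (2 * C ^ 2 * v)) ≤ M / 2 := by
    have hsgn (u : ℝ) : Ψ u * F' u / (C ^ 2 * v) - f u ≤ 0 := by
      rw [sub_nonpos, div_le_iff₀ (by positivity)]
      calc Ψ u * F' u ≤ C * (v * f u) * C :=
            mul_le_mul (hΨb u).2 (hF' u).2 (hF'pos u).le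
              (mul_pos hC (mul_pos hv' (hfpos u))).le
        _ = _ := by ring
    have h1 := le_of_hasDerivAt_sign (u₀ := u₀) (fun u => (hHd C hC u).neg)
      (fun u hu => neg_nonneg.2 (mul_nonpos_of_nonneg_of_nonpos
        (sub_nonneg.2 (hu₀ ▸ hmono.monotone hu))
        (mul_nonpos_of_nonneg_of_nonpos (Real.exp_pos _).le (hsgn u))))
      (fun u hu => neg_nonpos.2 (mul_nonneg_of_nonpos_of_nonpos
        (sub_nonpos.2 (hu₀ ▸ hmono.monotone hu))
        (mul_nonpos_of_nonneg_of_nonpos (Real.exp_pos _).le (hsgn u)))) u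
    simpa [hu₀, hΨ₀] using h1
  have hlower (u : ℝ) : M / 2 ≤ Ψ u * Real.exp ((F u - m) ^ 2 / (2 * c ^ 2 * v)) := by
    have hsgn (u : ℝ) : 0 ≤ Ψ u * F' u / (c ^ 2 * v) - f u := by
      rw [sub_nonneg, le_div_iff₀ (by positivity)]
      calc f u * (c ^ 2 * v) = c * (v * f u) * c := by ring
        _ ≤ Ψ u * F' u := mul_le_mul (hΨb u).1 (hF' u).1 hc.le (hΨpos u).le
    have h1 := le_of_hasDerivAt_sign (u₀ := u₀) (hHd c hc)
      (fun u hu => mul_nonneg (sub_nonneg.2 (hu₀ ▸ hmono.monotone hu))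
        (mul_nonneg (Real.exp_pos _).le (hsgn u)))
      (fun u hu => mul_nonpos_of_nonpos_of_nonneg (sub_nonpos.2 (hu₀ ▸ hmono.monotone hu))
        (mul_nonneg (Real.exp_pos _).le (hsgn u))) u
    simpa [hu₀, hΨ₀] using h1
  set q : ℝ → ℝ := Function.invFun F
  have hq (u : ℝ) : q (F u) = u := Function.leftInverse_invFun hmono.injective u
  refine ⟨fun x => f (q x) / F' (q x), map_gaussianReal_eq_withDensity hv hF hF'pos
    ⟨hmono.injective, hsurj⟩ fun u => by rw [hq], fun x => ?_⟩
  obtain ⟨u, rfl⟩ := hsurj x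
  simp only [hq]
  constructor
  · calc M / (2 * C ^ 2 * v) * Real.exp (-(F u - m) ^ 2 / (2 * c ^ 2 * v))
        = M / 2 * Real.exp (-(F u - m) ^ 2 / (2 * c ^ 2 * v)) / (C ^ 2 * v) := by
          field_simp
      _ ≤ Ψ u * Real.exp ((F u - m) ^ 2 / (2 * c ^ 2 * v)) *
            Real.exp (-(F u - m) ^ 2 / (2 * c ^ 2 * v)) / (C ^ 2 * v) := by
          gcongr
          exact hlower u
      _ = Ψ u / (C ^ 2 * v) := by
          rw [mul_assoc, ← Real.exp_add, neg_div, add_neg_cancel, Real.exp_zero, mul_one]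
      _ ≤ f u / F' u := by
          rw [div_le_div_iff₀ (by positivity) (hF'pos u)]
          calc Ψ u * F' u ≤ C * (v * f u) * C :=
                mul_le_mul (hΨb u).2 (hF' u).2 (hF'pos u).le
                  (mul_pos hC (mul_pos hv' (hfpos u))).le
            _ = _ := by ring
  · calc f u / F' u ≤ Ψ u / (c ^ 2 * v) := by
          rw [div_le_div_iff₀ (hF'pos u) (by positivity)]
          calc f u * (c ^ 2 * v) = c * (v * f u) * c := by ring
            _ ≤ Ψ u * F' u := mul_le_mul (hΨb u).1 (hF' u).1 hc.le (hΨpos u).le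
      _ = Ψ u * Real.exp ((F u - m) ^ 2 / (2 * C ^ 2 * v)) *
            Real.exp (-(F u - m) ^ 2 / (2 * C ^ 2 * v)) / (c ^ 2 * v) := by
          rw [mul_assoc, ← Real.exp_add, neg_div, add_neg_cancel, Real.exp_zero, mul_one]
      _ ≤ M / 2 * Real.exp (-(F u - m) ^ 2 / (2 * C ^ 2 * v)) / (c ^ 2 * v) := by
          gcongr
          exact hupper u
      _ = _ := by field_simp

/-- Theorem 3.1 (second part): Gaussian two-sided density bounds for
`Z = s·(P_a h')(A+G)` with `G` centered Gaussian of variance `ι`. -/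
theorem stmt_7 {Ω : Type*} [MeasurableSpace Ω] (P : Measure Ω) [IsProbabilityMeasure P]
    (a ι s : ℝ) (ha : 0 < a) (hι : 0 < ι) (hs : s ≠ 0) (A : ℝ)
    (h : ℝ → ℝ) (hh : ContDiff ℝ 2 h) (ctil Ctil : ℝ) (hctil : 0 < ctil)
    (hder2 : ∀ x : ℝ, ctil ≤ deriv (deriv h) x ∧ deriv (deriv h) x ≤ Ctil)
    (G : Ω → ℝ) (hG : Measure.map G P = gaussianReal 0 ⟨ι, hι.le⟩)
    (Z : Ω → ℝ) (hZ : Z = fun ω => s * heatP a (deriv h) (A + G ω))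
    (EZ : ℝ) (hEZ : EZ = ∫ ω, Z ω ∂P) :
    ∃ p : ℝ → ℝ,
      Measure.map Z P = volume.withDensity (fun x => ENNReal.ofReal (p x)) ∧
      ∀ᵐ x ∂(volume : Measure ℝ),
        (∫ ω, |Z ω - EZ| ∂P) / (2 * Ctil ^ 2 * s ^ 2 * ι) *
            Real.exp (-(x - EZ) ^ 2 / (2 * ctil ^ 2 * s ^ 2 * ι)) ≤ p x ∧
        p x ≤ (∫ ω, |Z ω - EZ| ∂P) / (2 * ctil ^ 2 * s ^ 2 * ι) *
            Real.exp (-(x - EZ) ^ 2 / (2 * Ctil ^ 2 * s ^ 2 * ι)) := by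
  set v : ℝ≥0 := ⟨ι, hι.le⟩
  have hv : v ≠ 0 := fun h0 => hι.ne' (congrArg NNReal.toReal h0)
  have hvι : (v : ℝ) = ι := rfl
  obtain ⟨w, rfl⟩ : ∃ w : ℝ≥0, (w : ℝ) = a := ⟨⟨a, ha.le⟩, rfl⟩
  have hw : w ≠ 0 := fun h0 => ha.ne' (by rw [h0, NNReal.coe_zero])
  have hGm : AEMeasurable G P := by
    by_contra hcon
    rw [Measure.map_of_not_aemeasurable hcon] at hG
    exact IsProbabilityMeasure.ne_zero (gaussianReal 0 v) hG.symm
  have hdh : ContDiff ℝ 1 (deriv h) := by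
    have h2 : ContDiff ℝ (1 + 1) h := by simpa [one_add_one_eq_two] using hh
    exact (contDiff_succ_iff_deriv.1 h2).2.2
  have hd1 (u : ℝ) : HasDerivAt (deriv h) (deriv (deriv h) u) u :=
    (hdh.differentiable one_ne_zero u).hasDerivAt
  have hd2 : Continuous (deriv (deriv h)) := hdh.continuous_deriv le_rfl
  have hderiv (x : ℝ) : HasDerivAt (heatP w (deriv h))
      (∫ z, deriv (deriv h) (x + z) ∂gaussianReal 0 w) x := by
    rw [funext (heatP_eq_integral_gaussianReal hw (deriv h))]
    exact hasDerivAt_integral_add_gaussianReal hd1 hd2 (C := Ctil)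
      (fun u => (abs_of_pos (hctil.trans_le (hder2 u).1)).trans_le (hder2 u).2) x
  have hbound (x : ℝ) := integral_mem_bounds (μ := gaussianReal 0 w)
    (g := fun z => deriv (deriv h) (x + z)) (c := ctil) (C := Ctil)
    (hd2.comp (continuous_const.add continuous_id)).aestronglyMeasurable fun z => hder2 (x + z)
  set D : ℝ → ℝ := fun x => ∫ z, deriv (deriv h) (x + z) ∂gaussianReal 0 w
  -- reflecting `G` when `s < 0` makes `Z` an increasing function of a Gaussian variable
  obtain ⟨e, he, hes⟩ : ∃ e : ℝ, (e = 1 ∨ e = -1) ∧ s * e = |s| := by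
    rcases le_total 0 s with h0 | h0
    · exact ⟨1, Or.inl rfl, by rw [abs_of_nonneg h0, mul_one]⟩
    · exact ⟨-1, Or.inr rfl, by rw [abs_of_nonpos h0]; ring⟩
  have hee : e * e = 1 := by rcases he with rfl | rfl <;> norm_num
  set F : ℝ → ℝ := fun u => s * heatP w (deriv h) (A + e * u) with hFdef
  have hF (u : ℝ) : HasDerivAt F (|s| * D (A + e * u)) u := by
    have h1 : HasDerivAt (fun u => A + e * u) e u := by
      simpa using ((hasDerivAt_id u).const_mul e).const_add A
    convert! ((hderiv (A + e * u)).comp u h1).const_mul s using 1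
    rw [← hes]
    ring
  have hF' (u : ℝ) : |s| * ctil ≤ |s| * D (A + e * u) ∧ |s| * D (A + e * u) ≤ |s| * Ctil :=
    ⟨mul_le_mul_of_nonneg_left (hbound _).1 (abs_nonneg s),
      mul_le_mul_of_nonneg_left (hbound _).2 (abs_nonneg s)⟩
  have hFcont : Continuous F := continuous_iff_continuousAt.2 fun u => (hF u).continuousAt
  have heG : AEMeasurable (fun ω => e * G ω) P := hGm.const_mul e
  have hlaw : Measure.map (fun ω => e * G ω) P = gaussianReal 0 v := by
    have h1 : Measure.map (fun ω => e * G ω) P = Measure.map (fun x => e * x) (Measure.map G P) :=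
      (AEMeasurable.map_map_of_aemeasurable (by fun_prop) hGm).symm
    rw [h1, hG, gaussianReal_map_const_mul, mul_zero]
    congr 1
    ext
    simp [pow_two, hee]
  have hZF : Z = fun ω => F (e * G ω) := by
    rw [hZ]
    funext ω
    simp only [hFdef, ← mul_assoc, hee, one_mul]
  have hmap : Measure.map Z P = Measure.map F (gaussianReal 0 v) := by
    rw [← hlaw, AEMeasurable.map_map_of_aemeasurable hFcont.aemeasurable heG, hZF]
    rfl
  have hm : EZ = ∫ x, F x ∂gaussianReal 0 v := by
    rw [hEZ, hZF, ← hlaw, integral_map heG hFcont.aestronglyMeasurable]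
  have hM : ∫ ω, |Z ω - EZ| ∂P = ∫ x, |F x - EZ| ∂gaussianReal 0 v := by
    rw [← hlaw, hZF, integral_map heG (f := fun x => |F x - EZ|)
      (hFcont.sub continuous_const).abs.aestronglyMeasurable]
  obtain ⟨p, hp, hb⟩ := exists_density_bounds_gaussianReal hv
    (mul_pos (abs_pos.2 hs) hctil) hF hF' hm
  refine ⟨p, hmap.trans hp, ae_of_all _ fun x => ?_⟩
  have h1 (b : ℝ) : 2 * (|s| * b) ^ 2 * (v : ℝ) = 2 * b ^ 2 * s ^ 2 * ι := by
    rw [mul_pow, sq_abs, hvι]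
    ring
  simpa only [h1, hM] using hb x
end
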